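/- Fix θ > 0 and let u_n(θ) be the smallest maximizer of k ↦ L_n(θ,k) on {1,…,n}, and u_n*(θ) = θ log n − θψ(θ) − 1/2. Then the set A = { n ∈ ℕ : u_n(θ) = ⌊u_n*(θ) + 1/2⌋ } has asymptotic density one: (1/n)·#(A ∩ {1,…,n}) → 1 as n → ∞. -/

import Mathlib

open Real Filter

/-- The Ewens probability mass function with parameter `θ`. -/
noncomputable def ewensPMF (n : ℕ) (θ : ℝ) (k : ℕ) : ℝ :=
  θ ^ k * ((ascPochhammer ℕ n).coeff k : ℝ) / (ascPochhammer ℝ n).eval θ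

/-- The digamma function `ψ(θ) = Γ′(θ)/Γ(θ)`, the derivative of `log ∘ Γ`. -/
noncomputable def digamma (θ : ℝ) : ℝ := deriv (fun x => Real.log (Real.Gamma x)) θ

/-- `u_n*(θ) = θ log n − θψ(θ) − 1/2`. -/
noncomputable def uStar (n : ℕ) (θ : ℝ) : ℝ := θ * Real.log n - θ * digamma θ - 1 / 2

/-- `u` is the smallest maximizer of `k ↦ L_n(θ,k)` on `{1,…,n}`. -/
def IsLeastMode (θ : ℝ) (n u : ℕ) : Prop :=
  u ∈ Finset.Icc 1 n ∧ (∀ k ∈ Finset.Icc 1 n, ewensPMF n θ k ≤ ewensPMF n θ u) ∧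
    ∀ v ∈ Finset.Icc 1 n, (∀ k ∈ Finset.Icc 1 n, ewensPMF n θ k ≤ ewensPMF n θ v) → u ≤ v

open Polynomial in
/-- The `k`-th elementary symmetric function of the values `r i`, `i ∈ s`, as a coefficient
of `∏ i ∈ s, (1 + r i X)`. -/
noncomputable def symmCoeff {ι : Type*} (r : ι → ℝ) (s : Finset ι) (k : ℕ) : ℝ :=
  (∏ i ∈ s, (1 + C (r i) * X)).coeff k

namespace symmCoeff

variable {ι : Type*} {r : ι → ℝ} {s : Finset ι}

theorem zero_right : symmCoeff r s 0 = 1 := by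
  simp [symmCoeff, Polynomial.coeff_zero_eq_eval_zero, Polynomial.eval_prod]

theorem sum_div_one_add_le (hr : ∀ i ∈ s, 0 ≤ r i) :
    ∑ i ∈ s, r i / (1 + r i) ≤ ∑ i ∈ s, r i :=
  Finset.sum_le_sum fun i hi => div_le_self (hr i hi) (by linarith [hr i hi])

theorem sum_sub_sum_sq_le (hr : ∀ i ∈ s, 0 ≤ r i) :
    ∑ i ∈ s, r i - ∑ i ∈ s, r i ^ 2 ≤ ∑ i ∈ s, r i / (1 + r i) := by
  rw [← Finset.sum_sub_distrib]
  refine Finset.sum_le_sum fun i hi => ?_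
  have h := hr i hi
  rw [le_div_iff₀ (by positivity)]
  nlinarith [pow_nonneg h 3]

variable [DecidableEq ι]

theorem insert_succ {i : ι} (hi : i ∉ s) (k : ℕ) :
    symmCoeff r (insert i s) (k + 1) = symmCoeff r s (k + 1) + r i * symmCoeff r s k := by
  simp only [symmCoeff]
  rw [Finset.prod_insert hi, add_mul, one_mul, mul_assoc, Polynomial.coeff_add,
    Polynomial.coeff_C_mul, Polynomial.coeff_X_mul]

theorem erase_succ {i : ι} (hi : i ∈ s) (k : ℕ) :
    symmCoeff r s (k + 1) =
      symmCoeff r (s.erase i) (k + 1) + r i * symmCoeff r (s.erase i) k := by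
  conv_lhs => rw [← Finset.insert_erase hi]
  exact insert_succ (Finset.notMem_erase i s) k

theorem succ_mul (k : ℕ) :
    (k + 1) * symmCoeff r s (k + 1) = ∑ i ∈ s, r i * symmCoeff r (s.erase i) k := by
  have h := congrArg (fun p => Polynomial.coeff p k)
    (Polynomial.derivative_prod_finset (s := s) (f := fun i => 1 + Polynomial.C (r i) * Polynomial.X))
  simp only [Polynomial.coeff_derivative, Polynomial.finsetSum_coeff] at h
  rw [mul_comm, symmCoeff, h]
  refine Finset.sum_congr rfl fun i _ => ?_
  simp [symmCoeff, mul_comm (r i)]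

theorem nonneg (hr : ∀ i ∈ s, 0 ≤ r i) (k : ℕ) : 0 ≤ symmCoeff r s k := by
  induction s using Finset.induction_on generalizing k with
  | empty => rcases k with _ | k <;> simp [symmCoeff, Polynomial.coeff_one]
  | insert i s hi ih =>
    have hs := ih fun j hj => hr j (Finset.mem_insert_of_mem hj)
    rcases k with _ | k
    · simp [zero_right]
    · rw [insert_succ hi]
      exact add_nonneg (hs _) (mul_nonneg (hr i (Finset.mem_insert_self i s)) (hs _))

theorem pos (hr : ∀ i ∈ s, 0 < r i) {k : ℕ} (hk : k ≤ s.card) : 0 < symmCoeff r s k := by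
  induction s using Finset.induction_on generalizing k with
  | empty =>
    obtain rfl : k = 0 := by simpa using hk
    simp [zero_right]
  | insert i s hi ih =>
    have hr' : ∀ j ∈ s, 0 < r j := fun j hj => hr j (Finset.mem_insert_of_mem hj)
    rcases k with _ | k
    · simp [zero_right]
    · rw [insert_succ hi]
      rw [Finset.card_insert_of_notMem hi] at hk
      exact add_pos_of_nonneg_of_pos (nonneg (fun j hj => (hr' j hj).le) _)
        (mul_pos (hr i (Finset.mem_insert_self i s)) (ih hr' (by omega)))

theorem erase_le (hr : ∀ i ∈ s, 0 ≤ r i) {i : ι} (hi : i ∈ s) (k : ℕ) :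
    symmCoeff r (s.erase i) k ≤ symmCoeff r s k := by
  rcases k with _ | k
  · simp [zero_right]
  · rw [erase_succ hi]
    exact le_add_of_nonneg_right (mul_nonneg (hr i hi)
      (nonneg (fun j hj => hr j (Finset.mem_of_mem_erase hj)) _))

theorem succ_mul_le (hr : ∀ i ∈ s, 0 ≤ r i) (k : ℕ) :
    (k + 1) * symmCoeff r s (k + 1) ≤ (∑ i ∈ s, r i) * symmCoeff r s k := by
  rw [succ_mul, Finset.sum_mul]
  exact Finset.sum_le_sum fun i hi => mul_le_mul_of_nonneg_left (erase_le hr hi k) (hr i hi)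

theorem le_succ_mul (hr : ∀ i ∈ s, 0 ≤ r i) (k : ℕ) :
    (∑ i ∈ s, r i) * symmCoeff r s (k + 1) - (∑ i ∈ s, r i ^ 2) * symmCoeff r s k ≤
      (k + 2) * symmCoeff r s (k + 2) := by
  have h := succ_mul (r := r) (s := s) (k + 1)
  push_cast at h
  rw [show (k : ℝ) + 2 = k + 1 + 1 by ring, h, Finset.sum_mul, Finset.sum_mul,
    ← Finset.sum_sub_distrib]
  refine Finset.sum_le_sum fun i hi => ?_
  have h1 := mul_le_mul_of_nonneg_left (erase_le hr hi k) (sq_nonneg (r i))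
  rw [erase_succ hi]
  nlinarith

/-- Lower bound for consecutive ratios, valid up to twice the (corrected) sum of the `r i`. -/
theorem mul_le_succ_mul (hr : ∀ i ∈ s, 0 ≤ r i) {B S : ℝ} (hB : 0 < B)
    (hS : ∑ i ∈ s, r i ^ 2 ≤ S) (hBS : B + 2 * S ≤ ∑ i ∈ s, r i) {k : ℕ}
    (hk : (k : ℝ) + 1 ≤ 2 * B) :
    B * symmCoeff r s k ≤ (k + 1) * symmCoeff r s (k + 1) := by
  have hS0 : 0 ≤ S := (Finset.sum_nonneg fun i _ => sq_nonneg (r i)).trans hS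
  induction k with
  | zero =>
    have h := succ_mul (r := r) (s := s) 0
    simp only [zero_right, mul_one] at h ⊢
    rw [h]
    linarith
  | succ k ih =>
    push_cast at hk ⊢
    have h0 := nonneg hr k
    have h1 := nonneg hr (k + 1)
    have h2 := le_succ_mul hr k
    have h3 : symmCoeff r s k ≤ 2 * symmCoeff r s (k + 1) := by
      have h4 := ih (by linarith)
      have h5 : ((k : ℝ) + 1) * symmCoeff r s (k + 1) ≤ 2 * B * symmCoeff r s (k + 1) :=
        mul_le_mul_of_nonneg_right (by linarith) h1
      refine le_of_mul_le_mul_left (a := B) ?_ hB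
      linarith
    have h6 := mul_le_mul hS h3 h0 hS0
    have h7 := mul_le_mul_of_nonneg_right hBS h1
    rw [show (k : ℝ) + 1 + 1 = k + 2 by ring, show k + 1 + 1 = k + 2 from rfl]
    linarith

/-- In a window around the sum of the `r i`, the recursion
`(k + 2) e_{k+2} ≈ (∑ r i / (1 + r i)) e_{k+1}` holds with a small error. -/
theorem abs_succ_mul_sub_le (hr : ∀ i ∈ s, 0 ≤ r i) {B S M ε : ℝ} (hB : 0 < B)
    (hS : ∑ i ∈ s, r i ^ 2 ≤ S) (hM : ∀ i ∈ s, r i ≤ M)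
    (hBS : B + 2 * S + M ≤ ∑ i ∈ s, r i) (hε0 : 0 ≤ ε) (hε1 : ε ≤ 1) {k : ℕ}
    (hk1 : ∑ i ∈ s, r i ≤ (1 + ε) * (k + 1)) (hk2 : (k : ℝ) + 1 ≤ (1 + ε) * B) :
    |(k + 2) * symmCoeff r s (k + 2) - (∑ i ∈ s, r i / (1 + r i)) * symmCoeff r s (k + 1)| ≤
      2 * ε * S * symmCoeff r s (k + 1) := by
  have h := succ_mul (r := r) (s := s) (k + 1)
  push_cast at h
  have h1 := nonneg hr (k + 1)
  rw [show (k : ℝ) + 2 = k + 1 + 1 by ring, h, Finset.sum_mul, ← Finset.sum_sub_distrib]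
  refine (Finset.abs_sum_le_sum_abs _ _).trans ?_
  refine le_trans (b := ∑ i ∈ s, r i ^ 2 * (2 * ε * symmCoeff r s (k + 1))) ?_ ?_
  swap
  · rw [← Finset.sum_mul]
    have := mul_le_mul_of_nonneg_right hS
      (mul_nonneg (mul_nonneg zero_le_two hε0) h1)
    linarith
  refine Finset.sum_le_sum fun i hi => ?_
  have hri := hr i hi
  have hr' : ∀ j ∈ s.erase i, 0 ≤ r j := fun j hj => hr j (Finset.mem_of_mem_erase hj)
  have hsum := Finset.add_sum_erase s r hi
  have hsq := Finset.add_sum_erase s (fun j => r j ^ 2) hi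
  have hup := succ_mul_le hr' k
  have hlo := mul_le_succ_mul hr' hB (S := S) (by nlinarith [sq_nonneg (r i)])
    (by linarith [hM i hi]) (k := k) (by nlinarith)
  have hle := erase_le hr hi (k + 1)
  set b := symmCoeff r (s.erase i) k
  set c := symmCoeff r (s.erase i) (k + 1) with hc
  have hb0 : 0 ≤ b := nonneg hr' k
  have hc0 : 0 ≤ c := nonneg hr' (k + 1)
  have hcb : c ≤ (1 + ε) * b := by
    refine le_of_mul_le_mul_left (a := (k : ℝ) + 1) ?_ (by positivity)
    have : (∑ j ∈ s.erase i, r j) * b ≤ (1 + ε) * (k + 1) * b :=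
      mul_le_mul_of_nonneg_right (by linarith) hb0
    linarith
  have hbc : b ≤ (1 + ε) * c := by
    refine le_of_mul_le_mul_left (a := B) ?_ hB
    have := mul_le_mul_of_nonneg_right hk2 hc0
    linarith
  have hdiff : |c - b| ≤ 2 * ε * symmCoeff r s (k + 1) := by
    have hb2 : b ≤ 2 * c := hbc.trans (mul_le_mul_of_nonneg_right (by linarith) hc0)
    have e1 := mul_le_mul_of_nonneg_left hle hε0
    have e2 := mul_le_mul_of_nonneg_left hb2 hε0
    have e3 := mul_nonneg hε0 h1
    rw [abs_le]
    constructor <;> linarith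
  have hkey : r i * c - r i / (1 + r i) * symmCoeff r s (k + 1) =
      r i ^ 2 / (1 + r i) * (c - b) := by
    rw [erase_succ hi, ← hc]
    have : 1 + r i ≠ 0 := by positivity
    field_simp
    ring
  rw [hkey, abs_mul, abs_of_nonneg (by positivity)]
  refine mul_le_mul ?_ hdiff (abs_nonneg _) (sq_nonneg _)
  exact div_le_self (sq_nonneg _) (by linarith)

/-- If `∑ r i` is large, the coefficients increase up to `∑ r i / (1 + r i) - 2 ε S`. -/
theorem lt_succ_of_lt (hr : ∀ i ∈ s, 0 < r i) {S M ε : ℝ}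
    (hS : ∑ i ∈ s, r i ^ 2 ≤ S) (hM0 : 0 ≤ M) (hM : ∀ i ∈ s, r i ≤ M) (hε0 : 0 < ε) (hε1 : ε ≤ 1)
    (hbig : (1 + ε) * (2 * S + M + 1) ≤ ε * ∑ i ∈ s, r i) {k : ℕ} (hk : k ≤ s.card)
    (hlt : (k : ℝ) + 1 < ∑ i ∈ s, r i / (1 + r i) - 2 * ε * S) :
    symmCoeff r s k < symmCoeff r s (k + 1) := by
  have hr0 : ∀ i ∈ s, 0 ≤ r i := fun i hi => (hr i hi).le
  have hS0 : 0 ≤ S := (Finset.sum_nonneg fun i _ => sq_nonneg (r i)).trans hS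
  have hμ := sum_div_one_add_le hr0
  have hpos := pos hr hk
  set R := ∑ i ∈ s, r i
  have hR : 2 * (2 * S + M + 1) ≤ R := by
    refine le_of_mul_le_mul_left (a := ε) ?_ hε0
    nlinarith
  have hεS : 0 ≤ ε * S := by positivity
  rcases lt_or_ge ((k : ℝ) + 1) (R - 2 * S) with hlow | hwin
  · have h := mul_le_succ_mul hr0 (B := R - 2 * S) (by linarith) hS (by linarith) (k := k)
      (by linarith)
    refine lt_of_mul_lt_mul_left (a := (k : ℝ) + 1) ?_ (by positivity)
    exact (mul_lt_mul_of_pos_right hlow hpos).trans_le h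
  · obtain ⟨j, rfl⟩ : ∃ j, k = j + 1 := by
      refine Nat.exists_eq_succ_of_ne_zero ?_
      rintro rfl
      norm_num at hwin
      linarith
    push_cast at hwin hlt
    have h := abs_succ_mul_sub_le hr0 (B := R - 2 * S - M) (by linarith) hS hM (by linarith)
      hε0.le hε1 (k := j) (by nlinarith) (by nlinarith)
    have h' := (abs_le.1 h).1
    refine lt_of_mul_lt_mul_left (a := (j : ℝ) + 2) ?_ (by positivity)
    have := mul_lt_mul_of_pos_right hlt hpos
    rw [show j + 1 + 1 = j + 2 from rfl]
    linarith

/-- If `∑ r i` is large, the coefficients decrease from `∑ r i / (1 + r i) + 2 ε S` on. -/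
theorem succ_lt_of_lt (hr : ∀ i ∈ s, 0 < r i) {S M ε : ℝ}
    (hS : ∑ i ∈ s, r i ^ 2 ≤ S) (hM0 : 0 ≤ M) (hM : ∀ i ∈ s, r i ≤ M) (hε0 : 0 < ε) (hε1 : ε ≤ 1)
    (hbig : (1 + ε) * (2 * S + M + 1) ≤ ε * ∑ i ∈ s, r i) {k : ℕ} (hk : k ≤ s.card)
    (hlt : ∑ i ∈ s, r i / (1 + r i) + 2 * ε * S < k + 1) :
    symmCoeff r s (k + 1) < symmCoeff r s k := by
  have hr0 : ∀ i ∈ s, 0 ≤ r i := fun i hi => (hr i hi).le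
  have hS0 : 0 ≤ S := (Finset.sum_nonneg fun i _ => sq_nonneg (r i)).trans hS
  have hμ := sum_sub_sum_sq_le hr0
  have hpos := pos hr hk
  set R := ∑ i ∈ s, r i
  have hR : 2 * (2 * S + M + 1) ≤ R := by
    refine le_of_mul_le_mul_left (a := ε) ?_ hε0
    nlinarith
  have hεS : 0 ≤ ε * S := by positivity
  rcases lt_or_ge R ((k : ℝ) + 1) with hhigh | hwin
  · refine lt_of_mul_lt_mul_left (a := (k : ℝ) + 1) ?_ (by positivity)
    exact (succ_mul_le hr0 k).trans_lt (mul_lt_mul_of_pos_right hhigh hpos)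
  · obtain ⟨j, rfl⟩ : ∃ j, k = j + 1 := by
      refine Nat.exists_eq_succ_of_ne_zero ?_
      rintro rfl
      norm_num at hlt
      linarith
    push_cast at hwin hlt
    have h := abs_succ_mul_sub_le hr0 (B := R - 2 * S - M) (by linarith) hS hM (by linarith)
      hε0.le hε1 (k := j) (by nlinarith) (by nlinarith)
    have h' := (abs_le.1 h).2
    refine lt_of_mul_lt_mul_left (a := (j : ℝ) + 2) ?_ (by positivity)
    have := mul_lt_mul_of_pos_right hlt hpos
    rw [show j + 1 + 1 = j + 2 from rfl]
    linarith

end symmCoeff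

theorem differentiableAt_log_Gamma {x : ℝ} (hx : 0 < x) :
    DifferentiableAt ℝ (fun y => Real.log (Real.Gamma y)) x := by
  refine (Real.differentiableAt_Gamma fun m => ?_).log (Real.Gamma_pos_of_pos hx).ne'
  have : (0 : ℝ) ≤ m := m.cast_nonneg
  linarith

theorem log_Gamma_add_one {x : ℝ} (hx : 0 < x) :
    Real.log (Real.Gamma (x + 1)) = Real.log x + Real.log (Real.Gamma x) := by
  rw [Real.Gamma_add_one hx.ne', Real.log_mul hx.ne' (Real.Gamma_pos_of_pos hx).ne']

theorem digamma_add_one {x : ℝ} (hx : 0 < x) : digamma (x + 1) = digamma x + 1 / x := by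
  unfold digamma
  rw [← deriv_comp_add_const]
  have h : (fun y => Real.log (Real.Gamma (y + 1))) =ᶠ[nhds x]
      fun y => Real.log (Real.Gamma y) + Real.log y := by
    filter_upwards [eventually_gt_nhds hx] with y hy
    rw [log_Gamma_add_one hy, add_comm]
  rw [h.deriv_eq, deriv_fun_add (differentiableAt_log_Gamma hx)
    (Real.differentiableAt_log hx.ne'), Real.deriv_log, one_div]

theorem digamma_add_nat {x : ℝ} (hx : 0 < x) (n : ℕ) :
    digamma (x + n) = digamma x + ∑ i ∈ Finset.range n, 1 / (x + i) := by
  induction n with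
  | zero => simp
  | succ n ih =>
    rw [Finset.sum_range_succ, ← add_assoc, ← ih, Nat.cast_succ, ← add_assoc,
      digamma_add_one (by positivity)]

theorem digamma_le_log {x : ℝ} (hx : 0 < x) : digamma x ≤ Real.log x := by
  have h := Real.convexOn_log_Gamma.deriv_le_slope (x := x) (y := x + 1) hx
    (by simp only [Set.mem_Ioi]; linarith) (by linarith) (differentiableAt_log_Gamma hx)
  simpa [slope_def_field, log_Gamma_add_one hx] using! h

theorem log_le_digamma_add {x : ℝ} (hx : 0 < x) : Real.log x ≤ digamma x + 1 / x := by
  rw [← digamma_add_one hx]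
  have h := Real.convexOn_log_Gamma.slope_le_deriv (x := x) (y := x + 1) hx
    (by simp only [Set.mem_Ioi]; linarith) (by linarith)
    (differentiableAt_log_Gamma (by linarith))
  simpa [slope_def_field, log_Gamma_add_one hx] using! h

theorem tendsto_digamma_add_nat_sub_log {x : ℝ} (hx : 0 < x) :
    Tendsto (fun n : ℕ => digamma (x + n) - Real.log n) atTop (nhds 0) := by
  have hlog : Tendsto (fun n : ℕ => Real.log (x + n) - Real.log n) atTop (nhds 0) := by
    have h : Tendsto (fun n : ℕ => Real.log (x / n + 1)) atTop (nhds 0) := by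
      have h0 := ((tendsto_const_div_atTop_nhds_zero_nat x).add_const 1).log (by norm_num)
      simpa using h0
    refine h.congr' ?_
    filter_upwards [eventually_gt_atTop 0] with n hn
    have hn' : (0 : ℝ) < n := by exact_mod_cast hn
    rw [← Real.log_div (by positivity) (by positivity), add_div, div_self hn'.ne']
  have hinv : Tendsto (fun n : ℕ => 1 / (x + n)) atTop (nhds 0) := by
    simp_rw [one_div]
    exact (tendsto_atTop_add_const_left _ x tendsto_natCast_atTop_atTop).inv_tendsto_atTop
  refine tendsto_of_tendsto_of_tendsto_of_le_of_le (by simpa using hlog.sub hinv) hlog ?_ ?_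
  · intro n
    have := log_le_digamma_add (x := x + n) (by positivity)
    rw [one_div] at this
    simp only
    linarith
  · intro n
    have := digamma_le_log (x := x + n) (by positivity)
    simp only
    linarith

/-- The mean of the Ewens distribution, minus one, in terms of the digamma function. -/
theorem sum_ewens_mean {θ : ℝ} (hθ : 0 < θ) (N : ℕ) :
    ∑ i ∈ Finset.range N, θ / (i + 1) / (1 + θ / (i + 1)) =
      θ * (digamma (θ + (N + 1 : ℕ)) - digamma θ) - 1 := by
  rw [digamma_add_nat hθ, Finset.sum_range_succ', add_sub_cancel_left, mul_add, Finset.mul_sum]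
  simp only [Nat.cast_zero, add_zero, mul_one_div_cancel hθ.ne', add_sub_cancel_right]
  refine Finset.sum_congr rfl fun i _ => ?_
  push_cast
  field_simp
  ring

theorem pow_mul_coeff_ascPochhammer {θ : ℝ} (N k : ℕ) :
    θ ^ (k + 1) * ((ascPochhammer ℕ (N + 1)).coeff (k + 1) : ℝ) =
      θ * N.factorial * symmCoeff (fun i : ℕ => θ / (i + 1)) (Finset.range N) k := by
  induction N generalizing k with
  | zero => rcases k with _ | k <;> simp [symmCoeff, Polynomial.coeff_one, Polynomial.coeff_X]
  | succ N ih =>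
    rw [ascPochhammer_succ_right, mul_add, Polynomial.coeff_add, Polynomial.coeff_mul_X,
      Polynomial.coeff_mul_natCast, Finset.range_add_one]
    have hN : (N : ℝ) + 1 ≠ 0 := by positivity
    rcases k with _ | k
    · have h0 : (ascPochhammer ℕ (N + 1)).coeff 0 = 0 := by
        rw [Polynomial.coeff_zero_eq_eval_zero, ascPochhammer_ne_zero_eval_zero _ N.succ_ne_zero]
      have h := ih 0
      rw [symmCoeff.zero_right] at h ⊢
      rw [h0, Nat.factorial_succ]
      push_cast
      linear_combination (N + 1) * h
    · rw [symmCoeff.insert_succ Finset.notMem_range_self, Nat.factorial_succ]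
      have h := ih k
      have h' := ih (k + 1)
      push_cast
      field_simp
      linear_combination θ * h + (N + 1) * h'

theorem IsLeastMode.symmCoeff_le {θ : ℝ} (hθ : 0 < θ) {N m : ℕ}
    (h : IsLeastMode θ (N + 1) (m + 1)) {k : ℕ} (hk : k ≤ N) :
    symmCoeff (fun i : ℕ => θ / (i + 1)) (Finset.range N) k ≤
      symmCoeff (fun i : ℕ => θ / (i + 1)) (Finset.range N) m := by
  have h1 := h.2.1 (k + 1) (Finset.mem_Icc.2 ⟨by omega, by omega⟩)
  unfold ewensPMF at h1
  rw [pow_mul_coeff_ascPochhammer, pow_mul_coeff_ascPochhammer,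
    div_le_div_iff_of_pos_right (ascPochhammer_pos _ _ hθ)] at h1
  exact le_of_mul_le_mul_left h1 (by positivity)

/-- Up to an arbitrarily small error, the mode is the integer part of the mean. -/
theorem eventually_mode_bounds {θ : ℝ} (hθ : 0 < θ) {δ : ℝ} (hδ : 0 < δ) :
    ∀ᶠ n : ℕ in atTop, ∀ u, IsLeastMode θ n u →
      θ * Real.log n - θ * digamma θ - 1 - δ < u ∧
        u < θ * Real.log n - θ * digamma θ + δ := by
  have hsum : Summable fun i : ℕ => (θ / ((i : ℝ) + 1)) ^ 2 := by
    have h := ((summable_nat_add_iff 1).2 (Real.summable_one_div_nat_pow.2 one_lt_two)).mul_left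
      (θ ^ 2)
    refine h.congr fun i => ?_
    push_cast
    rw [div_pow, mul_one_div]
  set S := ∑' i : ℕ, (θ / ((i : ℝ) + 1)) ^ 2
  have hS0 : 0 ≤ S := tsum_nonneg fun i => sq_nonneg _
  set ε := min 1 (δ / (4 * (S + 1)))
  have hε0 : 0 < ε := lt_min one_pos (by positivity)
  have hε1 : ε ≤ 1 := min_le_left _ _
  have hεS : 2 * ε * S ≤ δ / 2 := by
    have h : ε * (4 * (S + 1)) ≤ δ := (le_div_iff₀ (by positivity)).1 (min_le_right _ _)
    linarith
  have hR : Tendsto (fun N : ℕ => ε * ∑ i ∈ Finset.range N, θ / ((i : ℝ) + 1)) atTop atTop := by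
    refine Tendsto.const_mul_atTop hε0 ?_
    refine (Real.tendsto_sum_range_one_div_nat_succ_atTop.const_mul_atTop hθ).congr fun N => ?_
    rw [Finset.mul_sum]
    exact Finset.sum_congr rfl fun i _ => mul_one_div _ _
  have hψ := (tendsto_digamma_add_nat_sub_log hθ).const_mul θ
  rw [mul_zero] at hψ
  have hψ' := (tendsto_add_atTop_iff_nat 1).2 hψ
  rw [← map_add_atTop_eq_nat 1, eventually_map]
  filter_upwards [hR.eventually_ge_atTop ((1 + ε) * (2 * S + θ + 1)),
    hψ'.eventually (Metric.ball_mem_nhds (0 : ℝ) (half_pos hδ))] with N hN hmean u hu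
  have hmean' := abs_lt.1 (mem_ball_zero_iff.1 hmean)
  obtain ⟨m, rfl⟩ : ∃ m, u = m + 1 :=
    Nat.exists_eq_succ_of_ne_zero (Nat.one_le_iff_ne_zero.1 (Finset.mem_Icc.1 hu.1).1)
  have hmN : m ≤ N := by have := (Finset.mem_Icc.1 hu.1).2; omega
  have hr : ∀ i ∈ Finset.range N, 0 < θ / ((i : ℝ) + 1) := fun i _ => by positivity
  have hM : ∀ i ∈ Finset.range N, θ / ((i : ℝ) + 1) ≤ θ := fun i _ =>
    div_le_self hθ.le (by linarith [i.cast_nonneg (α := ℝ)])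
  have hS : ∑ i ∈ Finset.range N, (θ / ((i : ℝ) + 1)) ^ 2 ≤ S :=
    hsum.sum_le_tsum _ fun i _ => sq_nonneg _
  have hmu := sum_ewens_mean hθ N
  constructor
  · by_contra! hle
    have hmμ : (m : ℝ) + 1 < ∑ i ∈ Finset.range N, θ / (i + 1) / (1 + θ / (i + 1)) - 2 * ε * S := by
      rw [hmu]
      push_cast at *
      linarith
    have hμN : ∑ i ∈ Finset.range N, θ / ((i : ℝ) + 1) / (1 + θ / (i + 1)) ≤ N := by
      have h := Finset.sum_le_card_nsmul (Finset.range N)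
        (fun i : ℕ => θ / ((i : ℝ) + 1) / (1 + θ / (i + 1))) 1
        fun i hi => (div_le_one (by positivity)).2 (by linarith [hr i hi])
      simpa using h
    have hmN' : m + 1 ≤ N := by
      have : 0 ≤ 2 * ε * S := by positivity
      have h : (m : ℝ) + 1 ≤ N := by linarith
      exact_mod_cast h
    have hlt := symmCoeff.lt_succ_of_lt hr hS hθ.le hM hε0 hε1 hN (k := m) (by simpa using hmN) hmμ
    exact absurd (hu.symmCoeff_le hθ hmN') hlt.not_ge
  · by_contra! hle
    rcases m with _ | m
    · have hμ0 : 0 ≤ ∑ i ∈ Finset.range N, θ / ((i : ℝ) + 1) / (1 + θ / (i + 1)) :=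
        Finset.sum_nonneg fun i _ => by positivity
      rw [hmu] at hμ0
      push_cast at *
      linarith
    have hlt := symmCoeff.succ_lt_of_lt hr hS hθ.le hM hε0 hε1 hN (k := m)
      (by simp; omega) (by rw [hmu]; push_cast at *; linarith)
    exact absurd (hu.symmCoeff_le hθ (by omega)) hlt.not_ge

theorem card_le_of_forall_mem_Icc {s : Finset ℕ} {x y : ℝ} (hxy : x ≤ y)
    (hs : ∀ m ∈ s, x ≤ m ∧ m ≤ y) : (s.card : ℝ) ≤ y - x + 1 := by
  rcases s.eq_empty_or_nonempty with rfl | ⟨m, hm⟩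
  · simp only [Finset.card_empty, Nat.cast_zero]
    linarith
  have hy : 0 ≤ y := m.cast_nonneg.trans (hs m hm).2
  have hsub : s ⊆ Finset.Icc ⌈x⌉₊ ⌊y⌋₊ := fun k hk =>
    Finset.mem_Icc.2 ⟨Nat.ceil_le.2 (hs k hk).1, Nat.le_floor (hs k hk).2⟩
  have hmI := Finset.mem_Icc.1 (hsub hm)
  have hcard := Finset.card_le_card hsub
  rw [Nat.card_Icc] at hcard
  have h : s.card + ⌈x⌉₊ ≤ ⌊y⌋₊ + 1 := by omega
  have h' : (s.card : ℝ) + ⌈x⌉₊ ≤ ⌊y⌋₊ + 1 := by exact_mod_cast h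
  linarith [Nat.floor_le hy, Nat.le_ceil x]

theorem card_abs_log_sub_le {θ : ℝ} (hθ : 0 < θ) {δ : ℝ} (hδ : 0 ≤ δ) (w : ℝ) (n : ℕ) :
    (((Finset.Icc 1 n).filter fun m : ℕ => |θ * Real.log m - w| ≤ δ).card : ℝ) ≤
      Real.exp ((w + δ) / θ) - Real.exp ((w - δ) / θ) + 1 := by
  refine card_le_of_forall_mem_Icc (Real.exp_le_exp.2 (by gcongr; linarith)) fun m hm => ?_
  rw [Finset.mem_filter, Finset.mem_Icc, abs_le] at hm
  have hm0 : (0 : ℝ) < m := by exact_mod_cast hm.1.1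
  rw [← Real.le_log_iff_exp_le hm0, ← Real.log_le_iff_le_exp hm0, div_le_iff₀ hθ, le_div_iff₀ hθ]
  constructor <;> linarith [hm.2.1, hm.2.2]

open Classical in
/-- The number of `m ≤ n` for which `θ log m + c` is `δ`-close to an integer. -/
theorem card_log_near_int_le {θ : ℝ} (hθ : 0 < θ) (c : ℝ) {δ : ℝ} (hδ : 0 ≤ δ) (hδ1 : δ < 1)
    {n : ℕ} (hn : 1 ≤ n) :
    (((Finset.Icc 1 n).filter fun m : ℕ => ∃ z : ℤ, |θ * Real.log m + c - z| ≤ δ).card : ℝ) ≤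
      θ * Real.log n + 3 + n * (Real.exp (1 / θ) * (1 - Real.exp (-1 / θ))⁻¹ *
        (Real.exp (δ / θ) - Real.exp (-δ / θ))) := by
  have hn0 : (0 : ℝ) < n := by exact_mod_cast hn
  have hlogn : 0 ≤ Real.log n := Real.log_natCast_nonneg n
  set q := Real.exp (-1 / θ) with hq
  have hq1 : q < 1 := by
    rw [hq, Real.exp_lt_one_iff]
    exact div_neg_of_neg_of_pos (by norm_num) hθ
  set E := Real.exp (δ / θ) - Real.exp (-δ / θ) with hE
  have hE0 : 0 ≤ E := sub_nonneg.2 (Real.exp_le_exp.2 (by gcongr; linarith))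
  set z₁ : ℤ := ⌊θ * Real.log n + c⌋ + 1 with hz₁
  set J : ℕ := (z₁ - ⌊c⌋).toNat + 1 with hJ
  have hz₁le : (z₁ : ℝ) ≤ θ * Real.log n + c + 1 := by
    rw [hz₁]
    push_cast
    linarith [Int.floor_le (θ * Real.log n + c)]
  have hz₁c : ⌊c⌋ ≤ z₁ := by
    have : ⌊c⌋ ≤ ⌊θ * Real.log n + c⌋ := Int.floor_le_floor (by nlinarith)
    omega
  have hJle : (J : ℝ) ≤ θ * Real.log n + 3 := by
    have h : (J : ℤ) = z₁ - ⌊c⌋ + 1 := by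
      rw [hJ]
      push_cast
      rw [Int.toNat_of_nonneg (by omega)]
    have h' : (J : ℝ) = z₁ - ⌊c⌋ + 1 := by exact_mod_cast h
    linarith [Int.lt_floor_add_one c]
  have hsub : ((Finset.Icc 1 n).filter fun m : ℕ => ∃ z : ℤ, |θ * Real.log m + c - z| ≤ δ) ⊆
      (Finset.range J).biUnion fun j => (Finset.Icc 1 n).filter fun m : ℕ =>
        |θ * Real.log m - (z₁ - j - c)| ≤ δ := by
    intro m hm
    obtain ⟨hmI, z, hz⟩ := Finset.mem_filter.1 hm
    have hm1 := Finset.mem_Icc.1 hmI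
    have hm0 : (0 : ℝ) < m := by exact_mod_cast hm1.1
    have hlogm : 0 ≤ Real.log m := Real.log_natCast_nonneg m
    have hmn : Real.log m ≤ Real.log n := Real.log_le_log hm0 (by exact_mod_cast hm1.2)
    have hz' := abs_le.1 hz
    have hzz : z ≤ z₁ := by
      have h : z - 1 ≤ ⌊θ * Real.log n + c⌋ := by
        rw [Int.le_floor]
        push_cast
        nlinarith
      omega
    have hcz : ⌊c⌋ ≤ z := by
      have h : (⌊c⌋ : ℝ) < z + 1 := by nlinarith [Int.floor_le c]
      have h' : ⌊c⌋ < z + 1 := by exact_mod_cast h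
      omega
    refine Finset.mem_biUnion.2 ⟨(z₁ - z).toNat, Finset.mem_range.2 (by omega),
      Finset.mem_filter.2 ⟨hmI, ?_⟩⟩
    have hcast : (((z₁ - z).toNat : ℕ) : ℝ) = z₁ - z := by
      have h : (((z₁ - z).toNat : ℕ) : ℤ) = z₁ - z := Int.toNat_of_nonneg (by omega)
      exact_mod_cast h
    rw [hcast]
    convert hz using 2
    ring
  have hterm : ∀ j : ℕ, (((Finset.Icc 1 n).filter fun m : ℕ =>
      |θ * Real.log m - (z₁ - j - c)| ≤ δ).card : ℝ) ≤
        Real.exp ((z₁ - c) / θ) * E * q ^ j + 1 := by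
    intro j
    refine (card_abs_log_sub_le hθ hδ _ n).trans_eq ?_
    rw [hE, hq, ← Real.exp_nat_mul, mul_assoc, sub_mul, ← Real.exp_add, ← Real.exp_add, mul_sub,
      ← Real.exp_add, ← Real.exp_add]
    ring_nf
  have hgeom : ∑ j ∈ Finset.range J, q ^ j ≤ (1 - q)⁻¹ := by
    rw [← tsum_geometric_of_lt_one (Real.exp_pos _).le hq1]
    exact (summable_geometric_of_lt_one (Real.exp_pos _).le hq1).sum_le_tsum _
      fun j _ => pow_nonneg (Real.exp_pos _).le j
  have hexp : Real.exp ((z₁ - c) / θ) ≤ n * Real.exp (1 / θ) := by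
    nth_rewrite 1 [← Real.exp_log hn0]
    rw [← Real.exp_add]
    refine Real.exp_le_exp.2 ?_
    rw [div_le_iff₀ hθ, add_mul, one_div_mul_cancel hθ.ne']
    linarith
  have hq1' : 0 ≤ (1 - q)⁻¹ := inv_nonneg.2 (by linarith)
  calc _ ≤ (((Finset.range J).biUnion fun j => (Finset.Icc 1 n).filter fun m : ℕ =>
        |θ * Real.log m - (z₁ - j - c)| ≤ δ).card : ℝ) := by
        exact_mod_cast Finset.card_le_card hsub
    _ ≤ ∑ j ∈ Finset.range J, (((Finset.Icc 1 n).filter fun m : ℕ =>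
        |θ * Real.log m - (z₁ - j - c)| ≤ δ).card : ℝ) := by
        exact_mod_cast Finset.card_biUnion_le
    _ ≤ ∑ j ∈ Finset.range J, (Real.exp ((z₁ - c) / θ) * E * q ^ j + 1) :=
        Finset.sum_le_sum fun j _ => hterm j
    _ = J + Real.exp ((z₁ - c) / θ) * E * ∑ j ∈ Finset.range J, q ^ j := by
        rw [Finset.sum_add_distrib, ← Finset.mul_sum]
        simp [add_comm]
    _ ≤ (θ * Real.log n + 3) + n * Real.exp (1 / θ) * E * (1 - q)⁻¹ := by gcongr
    _ = _ := by ring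

theorem eq_floor_of_bounds {y δ : ℝ} {u : ℕ} (hlo : y - 1 - δ < u) (hhi : u < y + δ)
    (hy : ¬∃ z : ℤ, |y - z| ≤ δ) : (u : ℤ) = ⌊y⌋ := by
  push Not at hy
  have h1 := hy ⌊y⌋
  have h2 := hy (⌊y⌋ + 1)
  have hf := Int.floor_le y
  have hf' := Int.lt_floor_add_one y
  push_cast at h2
  rw [abs_of_nonneg (by linarith)] at h1
  rw [abs_of_nonpos (by linarith)] at h2
  have e1 : (⌊y⌋ : ℝ) < u + 1 := by linarith
  have e2 : (u : ℝ) < ⌊y⌋ + 1 := by linarith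
  have e1' : ⌊y⌋ < (u : ℤ) + 1 := by exact_mod_cast e1
  have e2' : (u : ℤ) < ⌊y⌋ + 1 := by exact_mod_cast e2
  omega

/-- The set of `n` for which the mode equals the nearest integer to `u_n*(θ)` has
asymptotic density one. -/
theorem ewens_mode_density_one (θ : ℝ) (hθ : 0 < θ) (u : ℕ → ℕ)
    (hu : ∀ n ≥ 1, IsLeastMode θ n (u n)) :
    Tendsto (fun n : ℕ =>
      (Set.ncard {m : ℕ | m ∈ Finset.Icc 1 n ∧ (u m : ℤ) = ⌊uStar m θ + 1 / 2⌋} : ℝ) / n)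
      atTop (nhds 1) := by
  classical
  have hcoe : ∀ n : ℕ, {m : ℕ | m ∈ Finset.Icc 1 n ∧ (u m : ℤ) = ⌊uStar m θ + 1 / 2⌋} =
      ((Finset.Icc 1 n).filter fun m : ℕ => (u m : ℤ) = ⌊uStar m θ + 1 / 2⌋ : Finset ℕ) :=
    fun n => by rw [Finset.coe_filter]
  simp_rw [hcoe, Set.ncard_coe_finset]
  refine tendsto_order.2 ⟨fun a ha => ?_, fun a ha => ?_⟩
  swap
  · filter_upwards [eventually_gt_atTop 0] with n hn
    have hn0 : (0 : ℝ) < n := by exact_mod_cast hn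
    refine lt_of_le_of_lt ((div_le_one hn0).2 ?_) ha
    have h := Finset.card_filter_le (Finset.Icc 1 n)
      fun m : ℕ => (u m : ℤ) = ⌊uStar m θ + 1 / 2⌋
    rw [Nat.card_Icc, Nat.add_sub_cancel] at h
    exact_mod_cast h
  have hη : 0 < (1 - a) / 2 := by linarith
  obtain ⟨δ, hδ0, hδ1, hKδ⟩ : ∃ δ : ℝ, 0 < δ ∧ δ < 1 ∧
      Real.exp (1 / θ) * (1 - Real.exp (-1 / θ))⁻¹ *
        (Real.exp (δ / θ) - Real.exp (-δ / θ)) < (1 - a) / 2 := by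
    have hcont : Continuous fun δ : ℝ => Real.exp (1 / θ) * (1 - Real.exp (-1 / θ))⁻¹ *
        (Real.exp (δ / θ) - Real.exp (-δ / θ)) := by fun_prop
    have h := hcont.tendsto 0
    simp only [neg_zero, zero_div, sub_self, mul_zero] at h
    have h' := (h.eventually_lt_const hη).filter_mono (nhdsWithin_le_nhds (s := Set.Ioi 0))
    obtain ⟨δ, hδ, hδ'⟩ := (h'.and (Ioo_mem_nhdsGT one_pos)).exists
    exact ⟨δ, hδ'.1, hδ'.2, hδ⟩
  obtain ⟨n₀, hn₀⟩ := eventually_atTop.1 (eventually_mode_bounds hθ hδ0)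
  have hsmall : Tendsto (fun n : ℕ => (n₀ + (θ * Real.log n + 3)) / (n : ℝ)) atTop (nhds 0) := by
    have hlog : Tendsto (fun n : ℕ => Real.log n / n) atTop (nhds 0) :=
      Real.isLittleO_log_id_atTop.tendsto_div_nhds_zero.comp tendsto_natCast_atTop_atTop
    have h := (hlog.const_mul θ).add (tendsto_const_div_atTop_nhds_zero_nat ((n₀ : ℝ) + 3))
    rw [mul_zero, add_zero] at h
    exact h.congr fun n => by ring
  filter_upwards [eventually_ge_atTop 1, hsmall.eventually_lt_const hη] with n hn hsmalln
  have hn0 : (0 : ℝ) < n := by exact_mod_cast hn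
  have hbad := card_log_near_int_le hθ (-(θ * digamma θ)) hδ0.le hδ1 hn
  set bad := (Finset.Icc 1 n).filter fun m : ℕ =>
    ∃ z : ℤ, |θ * Real.log m + -(θ * digamma θ) - z| ≤ δ with hbad_def
  set good := (Finset.Icc 1 n).filter fun m : ℕ => (u m : ℤ) = ⌊uStar m θ + 1 / 2⌋
    with hgood_def
  have hcover : Finset.Icc 1 n ⊆ good ∪ (bad ∪ Finset.range n₀) := by
    intro m hm
    simp only [Finset.mem_union, hbad_def, hgood_def, Finset.mem_filter, Finset.mem_range, hm,
      true_and]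
    by_contra! hcon
    obtain ⟨hne, hfar, hmn⟩ := hcon
    refine hne ?_
    obtain ⟨hlo, hhi⟩ := hn₀ m hmn (u m) (hu m (Finset.mem_Icc.1 hm).1)
    have hstar : uStar m θ + 1 / 2 = θ * Real.log m + -(θ * digamma θ) := by
      rw [uStar]
      ring
    rw [hstar]
    refine eq_floor_of_bounds (δ := δ) (by linarith) (by linarith) ?_
    rintro ⟨z, hz⟩
    exact (hfar z).not_ge hz
  have hcard : n ≤ good.card + (bad.card + n₀) := by
    have h1 := Finset.card_le_card hcover
    have h2 := Finset.card_union_le good (bad ∪ Finset.range n₀)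
    have h3 := Finset.card_union_le bad (Finset.range n₀)
    rw [Nat.card_Icc, Nat.add_sub_cancel] at h1
    rw [Finset.card_range] at h3
    omega
  have hcard' : (n : ℝ) ≤ good.card + (bad.card + n₀) := by exact_mod_cast hcard
  rw [div_lt_iff₀ hn0] at hsmalln
  rw [lt_div_iff₀ hn0]
  have hK := mul_lt_mul_of_pos_left hKδ hn0
  linarith
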